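/- arXiv:0807.0714 — 5 statements merged into one kernel-verified Lean document; each statement's English description precedes it below -/
import Mathlib

section
/- Let G be a group, α : G → ℤ a group homomorphism, and suppose there exists μ ∈ G with α(μ) = 1. Let ρ : G → SL₂(ℂ) be an irreducible homomorphism whose character is fixed by the twisting involution, i.e. for every g ∈ G one has (−1)^{α(g)} · tr ρ(g) = tr ρ(g). Then ρ is metabelian: for all γ₁, γ₂ in the commutator subgroup [G,G], ρ(γ₁)ρ(γ₂) = ρ(γ₂)ρ(γ₁). -/
open Matrix

abbrev SL2C := Matrix.SpecialLinearGroup (Fin 2) ℂ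

/-- A representation `ρ : G → SL₂(ℂ)` is irreducible if no nonzero vector of `ℂ²` is mapped
to a scalar multiple of itself by every `ρ g`. -/
def IsIrreducibleRep {G : Type*} [Group G] (ρ : G →* SL2C) : Prop :=
  ¬ ∃ v : Fin 2 → ℂ, v ≠ 0 ∧
      ∀ g : G, ∃ c : ℂ, (ρ g : Matrix (Fin 2) (Fin 2) ℂ) *ᵥ v = c • v

/-- A traceless element of `SL₂` is the negative of its inverse. -/
theorem Matrix.SpecialLinearGroup.inv_eq_neg_of_trace_eq_zero {R : Type*} [CommRing R]
    {A : Matrix.SpecialLinearGroup (Fin 2) R}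
    (hA : Matrix.trace (A : Matrix (Fin 2) (Fin 2) R) = 0) : A⁻¹ = -A := by
  rw [Matrix.trace_fin_two] at hA
  ext i j
  fin_cases i <;> fin_cases j <;>
    simp [Matrix.SpecialLinearGroup.coe_inv, Matrix.adjugate_fin_two]
  · exact eq_neg_of_add_eq_zero_right hA
  · exact eq_neg_of_add_eq_zero_left hA

/-- If `M` and `M * A` are traceless in `SL₂`, then conjugation by `M` inverts `A`. -/
theorem Matrix.SpecialLinearGroup.conj_eq_inv_of_trace_eq_zero {R : Type*} [CommRing R]
    {M A : Matrix.SpecialLinearGroup (Fin 2) R}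
    (hM : Matrix.trace (M : Matrix (Fin 2) (Fin 2) R) = 0)
    (hMA : Matrix.trace ((M * A : Matrix.SpecialLinearGroup (Fin 2) R) :
      Matrix (Fin 2) (Fin 2) R) = 0) :
    M * A * M⁻¹ = A⁻¹ := by
  have h := inv_eq_neg_of_trace_eq_zero hMA
  rw [inv_eq_neg_of_trace_eq_zero hM, mul_neg, ← neg_mul, ← h, _root_.mul_inv_rev,
    inv_mul_cancel_right]

/-- an irreducible `SL₂(ℂ)`-representation whose character is fixed by the
twisting involution `ι(ρ)(g) = (-1)^{α g} ρ(g)` is metabelian. -/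
theorem irreducible_char_fixed_by_twist_metabelian {G : Type*} [Group G]
    (α : G → ℤ) (hα : ∀ g h : G, α (g * h) = α g + α h)
    (μ : G) (hμ : α μ = 1)
    (ρ : G →* SL2C) (hirr : IsIrreducibleRep ρ)
    (hfix : ∀ g : G,
      ((-1 : ℂ) ^ (α g)) * Matrix.trace ((ρ g : Matrix (Fin 2) (Fin 2) ℂ))
        = Matrix.trace ((ρ g : Matrix (Fin 2) (Fin 2) ℂ))) :
    ∀ γ₁ ∈ commutator G, ∀ γ₂ ∈ commutator G, ρ γ₁ * ρ γ₂ = ρ γ₂ * ρ γ₁ := by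
  have trace_zero : ∀ g, α g = 1 → Matrix.trace (ρ g : Matrix (Fin 2) (Fin 2) ℂ) = 0 := by
    intro g hg
    have h := hfix g
    rw [hg, zpow_one, neg_one_mul] at h
    exact neg_eq_self.mp h
  have conj_inv : ∀ g, α g = 0 → ρ μ * ρ g * (ρ μ)⁻¹ = (ρ g)⁻¹ := by
    intro g hg
    refine SpecialLinearGroup.conj_eq_inv_of_trace_eq_zero (trace_zero μ hμ) ?_
    rw [← map_mul]
    exact trace_zero _ (by rw [hα, hμ, hg, add_zero])
  have α_commutator : ∀ γ ∈ commutator G, α γ = 0 := by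
    let φ : G →* Multiplicative ℤ := MonoidHom.mk' (fun g => Multiplicative.ofAdd (α g))
      fun g h => by rw [hα, ofAdd_add]
    intro γ hγ
    exact ofAdd_eq_one.mp (MonoidHom.mem_ker.mp (Abelianization.commutator_subset_ker φ hγ))
  intro γ₁ h₁ γ₂ h₂
  have h := conj_inv _ (α_commutator _ (mul_mem h₁ h₂))
  rw [map_mul, ← conj_mul, conj_inv _ (α_commutator _ h₁), conj_inv _ (α_commutator _ h₂),
    ← _root_.mul_inv_rev, _root_.inv_inj] at h
  exact h.symm
end

section
/- Let G be a group, α : G → ℤ a group homomorphism, and μ ∈ G with α(μ) = 1. Let ρ : G → SL₂(ℂ) be a homomorphism such that ρ(μ) = j = [[0,1],[−1,0]] and such that ρ(γ) is a diagonal matrix for every γ ∈ ker α. Then, with P = [[√−1, 0],[0, −√−1]] ∈ SL₂(ℂ), one has P ρ(g) P⁻¹ = (−1)^{α(g)} ρ(g) for every g ∈ G. In particular the character of the twisted representation ι(ρ) : g ↦ (−1)^{α(g)} ρ(g) coincides with the character of ρ. -/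
open Matrix

/-- The matrix `j = [[0,1],[-1,0]]` as an element of `SL₂(ℂ)`. -/
def Jmat : SL2C := ⟨!![(0 : ℂ), 1; -1, 0], by norm_num [Matrix.det_fin_two_of]⟩

/-- The matrix `P = [[√-1,0],[0,-√-1]]` as an element of `SL₂(ℂ)`. -/
def Pmat : SL2C :=
  ⟨!![Complex.I, 0; 0, -Complex.I], by
    simp [Matrix.det_fin_two_of, Complex.I_mul_I]⟩

theorem Pmat_conj_of_isDiag {A : SL2C} (hA : (A : Matrix (Fin 2) (Fin 2) ℂ).IsDiag) :
    Pmat * A * Pmat⁻¹ = A := by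
  have h01 : A 0 1 = 0 := hA (by decide)
  have h10 : A 1 0 = 0 := hA (by decide)
  have h : Pmat * A = A * Pmat := by
    ext i j
    simp only [Matrix.SpecialLinearGroup.coe_mul]
    fin_cases i <;> fin_cases j <;> simp [Pmat, Matrix.mul_apply, h01, h10, mul_comm]
  exact mul_inv_eq_of_eq_mul h

theorem Pmat_conj_Jmat : Pmat * Jmat * Pmat⁻¹ = -1 * Jmat := by
  have h : Pmat * Jmat = -1 * Jmat * Pmat := by
    ext i j
    simp only [Matrix.SpecialLinearGroup.coe_mul]
    fin_cases i <;> fin_cases j <;> simp [Pmat, Jmat, Matrix.mul_apply]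
  exact mul_inv_eq_of_eq_mul h

theorem Pmat_conj_Jmat_zpow (n : ℤ) : Pmat * Jmat ^ n * Pmat⁻¹ = (-1) ^ n * Jmat ^ n := by
  rw [← conj_zpow, Pmat_conj_Jmat, (Commute.neg_one_left Jmat).mul_zpow]

theorem coe_neg_one_zpow_mul (n : ℤ) (A : SL2C) :
    (((-1) ^ n * A : SL2C) : Matrix (Fin 2) (Fin 2) ℂ) =
      ((-1 : ℂ) ^ n) • (A : Matrix (Fin 2) (Fin 2) ℂ) := by
  have hsq : (-1 : SL2C) ^ (2 : ℤ) = 1 := by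
    rw [zpow_two, neg_mul_neg, one_mul]
  obtain ⟨k, rfl | rfl⟩ := Int.even_or_odd' n
  · simp [_root_.zpow_mul, hsq]
  · rw [_root_.zpow_add, _root_.zpow_mul, hsq, _root_.zpow_add₀ (by norm_num), _root_.zpow_mul]
    simp

/-- if `ρ(μ) = j` and `ρ` is diagonal on `ker α`, then conjugation by
`P = diag(i, -i)` realizes the twist `ι(ρ)(g) = (-1)^{α g} ρ(g)`; in particular the
character of `ι(ρ)` coincides with that of `ρ`. -/
theorem conj_by_P_realizes_twist {G : Type*} [Group G]
    (α : G → ℤ) (hα : ∀ g h : G, α (g * h) = α g + α h)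
    (μ : G) (hμ : α μ = 1)
    (ρ : G →* SL2C) (hmer : ρ μ = Jmat)
    (hdiag : ∀ γ : G, α γ = 0 → ((ρ γ : Matrix (Fin 2) (Fin 2) ℂ)).IsDiag) :
    (∀ g : G,
      ((Pmat * ρ g * Pmat⁻¹ : SL2C) : Matrix (Fin 2) (Fin 2) ℂ)
        = ((-1 : ℂ) ^ (α g)) • ((ρ g : Matrix (Fin 2) (Fin 2) ℂ))) ∧
    (∀ g : G,
      Matrix.trace (((-1 : ℂ) ^ (α g)) • ((ρ g : Matrix (Fin 2) (Fin 2) ℂ)))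
        = Matrix.trace ((ρ g : Matrix (Fin 2) (Fin 2) ℂ))) := by
  have key (g : G) : ((Pmat * ρ g * Pmat⁻¹ : SL2C) : Matrix (Fin 2) (Fin 2) ℂ)
      = ((-1 : ℂ) ^ (α g)) • (ρ g : Matrix (Fin 2) (Fin 2) ℂ) := by
    let φ : G →* Multiplicative ℤ := MonoidHom.mk' (fun g => Multiplicative.ofAdd (α g))
      fun g h => by rw [hα, ofAdd_add]
    have hzpow : α (μ ^ (-α g)) = -α g := by
      have h : φ (μ ^ (-α g)) = φ μ ^ (-α g) := map_zpow φ μ _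
      simpa [φ, hμ, ← ofAdd_zsmul] using congrArg Multiplicative.toAdd h
    obtain ⟨D, hD, hg⟩ : ∃ D : SL2C, Pmat * D * Pmat⁻¹ = D ∧ ρ g = D * Jmat ^ α g := by
      refine ⟨ρ (g * μ ^ (-α g)), Pmat_conj_of_isDiag (hdiag _ ?_), ?_⟩
      · rw [hα, hzpow, add_neg_cancel]
      · rw [← hmer, ← map_zpow, ← map_mul, mul_assoc, ← _root_.zpow_add, neg_add_cancel, zpow_zero,
          mul_one]
    have hcomm : Commute D ((-1) ^ α g) := (Commute.neg_one_right D).zpow_right _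
    rw [← coe_neg_one_zpow_mul, hg, ← conj_mul, hD, Pmat_conj_Jmat_zpow, hcomm.left_comm]
  refine ⟨key, fun g => ?_⟩
  rw [← key g, Matrix.SpecialLinearGroup.coe_mul, trace_mul_comm, ← Matrix.SpecialLinearGroup.coe_mul,
    inv_mul_cancel_left]
end

section
/- Let G be a group, μ ∈ G, and suppose G is generated by the set [G,G] ∪ {μ}, where [G,G] is the commutator subgroup. Let ρ : G → SL₂(ℂ) be an irreducible and metabelian homomorphism (the images under ρ of elements of [G,G] pairwise commute). Then there exists P ∈ SL₂(ℂ) such that P ρ(μ) P⁻¹ = [[0,1],[−1,0]] and P ρ(γ) P⁻¹ is a diagonal matrix for every γ ∈ [G,G]. -/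
open Matrix

lemma SL2C.coe_mul (A B : SL2C) : ((A * B : SL2C) : Matrix (Fin 2) (Fin 2) ℂ) =
    (A : Matrix (Fin 2) (Fin 2) ℂ) * (B : Matrix (Fin 2) (Fin 2) ℂ) :=
  rfl

lemma SL2C.coe_one : ((1 : SL2C) : Matrix (Fin 2) (Fin 2) ℂ) = 1 :=
  rfl

/-- Two planar vectors with vanishing determinant are proportional. -/
lemma exists_eq_smul_of_det_eq_zero {v w : Fin 2 → ℂ} (hv : v ≠ 0)
    (h : w 0 * v 1 - v 0 * w 1 = 0) : ∃ c : ℂ, w = c • v := by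
  by_cases h0 : v 0 = 0
  · have h1 : v 1 ≠ 0 := fun h1 => hv (by ext i; fin_cases i <;> simp [h0, h1])
    have hw : w 0 = 0 := by simpa [h0, h1] using h
    refine ⟨w 1 / v 1, ?_⟩
    ext i
    fin_cases i
    · simp [h0, hw]
    · simp [h1]
  · refine ⟨w 0 / v 0, ?_⟩
    ext i
    fin_cases i
    · simp [h0]
    · simp only [Fin.mk_one, Pi.smul_apply, smul_eq_mul]
      field_simp
      linear_combination -h

/-- A planar endomorphism acting by the same scalar on two independent vectors is scalar. -/
lemma mulVec_eq_smul_of_det_ne_zero {A : Matrix (Fin 2) (Fin 2) ℂ} {v w : Fin 2 → ℂ} {a : ℂ}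
    (hD : w 0 * v 1 - v 0 * w 1 ≠ 0) (hv : A *ᵥ v = a • v) (hw : A *ᵥ w = a • w)
    (x : Fin 2 → ℂ) : A *ᵥ x = a • x := by
  have hv0 := congrFun hv 0
  have hv1 := congrFun hv 1
  have hw0 := congrFun hw 0
  have hw1 := congrFun hw 1
  simp only [mulVec, dotProduct, Fin.sum_univ_two, Pi.smul_apply, smul_eq_mul] at hv0 hv1 hw0 hw1
  ext i
  apply mul_left_cancel₀ hD
  fin_cases i <;>
    simp only [mulVec, dotProduct, Fin.sum_univ_two, Pi.smul_apply, smul_eq_mul,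
      Fin.zero_eta, Fin.mk_one]
  · linear_combination (x 0 * v 1 - x 1 * v 0) * hw0 + (w 0 * x 1 - w 1 * x 0) * hv0
  · linear_combination (x 0 * v 1 - x 1 * v 0) * hw1 + (w 0 * x 1 - w 1 * x 0) * hv1

/-- An eigenvector of a non-scalar planar matrix is an eigenvector of every matrix commuting
with it. -/
lemma exists_mulVec_eq_smul_of_commute {A B : Matrix (Fin 2) (Fin 2) ℂ} {v : Fin 2 → ℂ} {a : ℂ}
    (hA : ¬ ∃ c : ℂ, ∀ x, A *ᵥ x = c • x) (hAB : A * B = B * A) (hv : v ≠ 0)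
    (hav : A *ᵥ v = a • v) : ∃ b : ℂ, B *ᵥ v = b • v := by
  by_contra hB
  have hD : (B *ᵥ v) 0 * v 1 - v 0 * (B *ᵥ v) 1 ≠ 0 := fun h =>
    hB (exists_eq_smul_of_det_eq_zero hv h)
  refine hA ⟨a, mulVec_eq_smul_of_det_ne_zero hD hav ?_⟩
  rw [mulVec_mulVec, hAB, ← mulVec_mulVec, hav, mulVec_smul]

lemma exists_eigenvector (A : Matrix (Fin 2) (Fin 2) ℂ) :
    ∃ (a : ℂ) (v : Fin 2 → ℂ), v ≠ 0 ∧ A *ᵥ v = a • v := by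
  obtain ⟨a, ha⟩ := Module.End.exists_eigenvalue (Matrix.toLin' A)
  obtain ⟨v, hv⟩ := ha.exists_hasEigenvector
  exact ⟨a, v, hv.2, by simpa using hv.apply_eq_smul⟩

/-- No nonzero vector is an eigenvector of the image of every element of a generating set of an
irreducible representation. -/
lemma IsIrreducibleRep.not_eigenvector {G : Type*} [Group G] {ρ : G →* SL2C}
    (hirr : IsIrreducibleRep ρ) {S : Set G} (hS : Subgroup.closure S = ⊤) {v : Fin 2 → ℂ}
    (hv : v ≠ 0)
    (h : ∀ g ∈ S, ∃ c : ℂ, (ρ g : Matrix (Fin 2) (Fin 2) ℂ) *ᵥ v = c • v) : False := by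
  refine hirr ⟨v, hv, fun g => ?_⟩
  have hg : g ∈ Subgroup.closure S := hS ▸ Subgroup.mem_top g
  induction hg using Subgroup.closure_induction with
  | mem x hx => exact h x hx
  | one => exact ⟨1, by rw [map_one, SL2C.coe_one, one_mulVec, one_smul]⟩
  | mul x y _ _ hx hy =>
    obtain ⟨c, hc⟩ := hx
    obtain ⟨d, hd⟩ := hy
    refine ⟨d * c, ?_⟩
    rw [map_mul, SL2C.coe_mul, ← mulVec_mulVec, hd, mulVec_smul, hc, smul_smul]
  | inv x _ hx =>
    obtain ⟨c, hc⟩ := hx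
    have hinv : (ρ x⁻¹ : Matrix (Fin 2) (Fin 2) ℂ) *ᵥ ((ρ x : Matrix (Fin 2) (Fin 2) ℂ) *ᵥ v)
        = v := by
      rw [mulVec_mulVec, ← SL2C.coe_mul, ← map_mul]
      rw [inv_mul_cancel, map_one, SL2C.coe_one, one_mulVec]
    rw [hc, mulVec_smul] at hinv
    have hc0 : c ≠ 0 := by
      rintro rfl
      exact hv (by simpa using hinv.symm)
    exact ⟨c⁻¹, (eq_inv_smul_iff₀ hc0).2 hinv⟩

/-- The planar Cayley–Hamilton identity for a matrix of determinant one, applied to a vector. -/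
lemma mulVec_mulVec_eq_trace_smul_sub (M : SL2C) (v : Fin 2 → ℂ) :
    (M : Matrix (Fin 2) (Fin 2) ℂ) *ᵥ ((M : Matrix (Fin 2) (Fin 2) ℂ) *ᵥ v) =
      (M : Matrix (Fin 2) (Fin 2) ℂ).trace • ((M : Matrix (Fin 2) (Fin 2) ℂ) *ᵥ v) - v := by
  have hdet := M.2
  rw [det_fin_two] at hdet
  ext i
  fin_cases i <;>
    simp only [mulVec, dotProduct, Fin.sum_univ_two, Pi.smul_apply, Pi.sub_apply, smul_eq_mul,
      trace_fin_two, Fin.zero_eta, Fin.mk_one]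
  · linear_combination -v 0 * hdet
  · linear_combination -v 1 * hdet

/-- If `v` and `M v` are independent eigenvectors of the matrices in `N` and `M (M v) = -v`, then
a single change of basis brings `M` to `Jmat` and makes every element of `N` diagonal. -/
lemma exists_conj_eq_Jmat {M : SL2C} {N : Set SL2C} {v w : Fin 2 → ℂ}
    (hD : w 0 * v 1 - v 0 * w 1 ≠ 0)
    (hMv : (M : Matrix (Fin 2) (Fin 2) ℂ) *ᵥ v = w)
    (hMw : (M : Matrix (Fin 2) (Fin 2) ℂ) *ᵥ w = -v)
    (hNv : ∀ B ∈ N, ∃ b : ℂ, (B : Matrix (Fin 2) (Fin 2) ℂ) *ᵥ v = b • v)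
    (hNw : ∀ B ∈ N, ∃ b : ℂ, (B : Matrix (Fin 2) (Fin 2) ℂ) *ᵥ w = b • w) :
    ∃ P : SL2C, P * M * P⁻¹ = Jmat ∧
      ∀ B ∈ N, ((P * B * P⁻¹ : SL2C) : Matrix (Fin 2) (Fin 2) ℂ).IsDiag := by
  obtain ⟨t, ht⟩ := IsAlgClosed.exists_pow_nat_eq (w 0 * v 1 - v 0 * w 1)⁻¹ two_pos
  have htD : t ^ 2 * (w 0 * v 1 - v 0 * w 1) = 1 := by rw [ht, inv_mul_cancel₀ hD]
  let Q : SL2C := ⟨!![t * w 0, t * v 0; t * w 1, t * v 1], by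
    rw [det_fin_two_of]
    linear_combination htD⟩
  refine ⟨Q⁻¹, ?_, fun B hB => ?_⟩
  · rw [inv_inv, mul_assoc, inv_mul_eq_iff_eq_mul]
    have hv0 := congrFun hMv 0
    have hv1 := congrFun hMv 1
    have hw0 := congrFun hMw 0
    have hw1 := congrFun hMw 1
    simp only [mulVec, dotProduct, Fin.sum_univ_two, Pi.neg_apply] at hv0 hv1 hw0 hw1
    apply Subtype.ext
    rw [SL2C.coe_mul, SL2C.coe_mul]
    ext i j
    fin_cases i <;> fin_cases j <;> simp [Q, Jmat, Matrix.mul_apply, Fin.sum_univ_two]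
    · linear_combination t * hw0
    · linear_combination t * hv0
    · linear_combination t * hw1
    · linear_combination t * hv1
  · obtain ⟨a, ha⟩ := hNv B hB
    obtain ⟨b, hb⟩ := hNw B hB
    have hBQ : (B : Matrix (Fin 2) (Fin 2) ℂ) * (Q : Matrix (Fin 2) (Fin 2) ℂ) =
        (Q : Matrix (Fin 2) (Fin 2) ℂ) * diagonal ![b, a] := by
      have hv0 := congrFun ha 0
      have hv1 := congrFun ha 1
      have hw0 := congrFun hb 0
      have hw1 := congrFun hb 1
      simp only [mulVec, dotProduct, Fin.sum_univ_two, Pi.smul_apply, smul_eq_mul]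
        at hv0 hv1 hw0 hw1
      ext i j
      fin_cases i <;> fin_cases j <;> simp [Q, Matrix.mul_apply, Fin.sum_univ_two]
      · linear_combination t * hw0
      · linear_combination t * hv0
      · linear_combination t * hw1
      · linear_combination t * hv1
    rw [inv_inv, mul_assoc, SL2C.coe_mul, SL2C.coe_mul, hBQ,
      ← Matrix.mul_assoc, ← SL2C.coe_mul, inv_mul_cancel,
      SL2C.coe_one, Matrix.one_mul]
    exact isDiag_diagonal _

/-- an irreducible metabelian representation of a group generated by its
commutator subgroup together with one element `μ` is conjugate to one sending `μ` to
`j = [[0,1],[-1,0]]` and the commutator subgroup to diagonal matrices. -/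
theorem irreducible_metabelian_conj_binaryDihedral_form {G : Type*} [Group G]
    (μ : G) (hgen : Subgroup.closure ((commutator G : Set G) ∪ {μ}) = ⊤)
    (ρ : G →* SL2C) (hirr : IsIrreducibleRep ρ)
    (hmeta : ∀ γ₁ ∈ commutator G, ∀ γ₂ ∈ commutator G, ρ γ₁ * ρ γ₂ = ρ γ₂ * ρ γ₁) :
    ∃ P : SL2C, P * ρ μ * P⁻¹ = Jmat ∧
      ∀ γ ∈ commutator G,
        (((P * ρ γ * P⁻¹ : SL2C) : Matrix (Fin 2) (Fin 2) ℂ)).IsDiag := by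
  obtain ⟨γ₀, hγ₀, hns⟩ : ∃ γ₀ ∈ commutator G,
      ¬ ∃ c : ℂ, ∀ x, (ρ γ₀ : Matrix (Fin 2) (Fin 2) ℂ) *ᵥ x = c • x := by
    by_contra! hscalar
    obtain ⟨a, v, hv, hav⟩ := exists_eigenvector (ρ μ : Matrix (Fin 2) (Fin 2) ℂ)
    refine hirr.not_eigenvector hgen hv ?_
    rintro g (hg | rfl)
    · obtain ⟨c, hc⟩ := hscalar g hg
      exact ⟨c, hc v⟩
    · exact ⟨a, hav⟩
  obtain ⟨a, v, hv, hav⟩ := exists_eigenvector (ρ γ₀ : Matrix (Fin 2) (Fin 2) ℂ)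
  have hNv : ∀ γ ∈ commutator G,
      ∃ b : ℂ, (ρ γ : Matrix (Fin 2) (Fin 2) ℂ) *ᵥ v = b • v := fun γ hγ =>
    exists_mulVec_eq_smul_of_commute hns
      (by simpa using congrArg Subtype.val (hmeta γ₀ hγ₀ γ hγ)) hv hav
  have hconj : ∀ u : Fin 2 → ℂ,
      (∀ γ ∈ commutator G, ∃ b : ℂ, (ρ γ : Matrix (Fin 2) (Fin 2) ℂ) *ᵥ u = b • u) →
      ∀ γ ∈ commutator G, ∃ b : ℂ, (ρ γ : Matrix (Fin 2) (Fin 2) ℂ) *ᵥ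
        ((ρ μ : Matrix (Fin 2) (Fin 2) ℂ) *ᵥ u) =
          b • ((ρ μ : Matrix (Fin 2) (Fin 2) ℂ) *ᵥ u) := by
    intro u hu γ hγ
    obtain ⟨b, hb⟩ := hu (μ⁻¹ * γ * μ) (by
      simpa using (inferInstance : (commutator G).Normal).conj_mem γ hγ μ⁻¹)
    refine ⟨b, ?_⟩
    rw [← mulVec_smul, ← hb, mulVec_mulVec, mulVec_mulVec, ← SL2C.coe_mul,
      ← SL2C.coe_mul, ← map_mul, ← map_mul,
      show μ * (μ⁻¹ * γ * μ) = γ * μ by group]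
  set w := (ρ μ : Matrix (Fin 2) (Fin 2) ℂ) *ᵥ v with hw
  have hNw : ∀ γ ∈ commutator G,
      ∃ b : ℂ, (ρ γ : Matrix (Fin 2) (Fin 2) ℂ) *ᵥ w = b • w := hconj v hNv
  have hD : w 0 * v 1 - v 0 * w 1 ≠ 0 := by
    intro h
    refine hirr.not_eigenvector hgen hv ?_
    rintro g (hg | rfl)
    · exact hNv g hg
    · exact exists_eq_smul_of_det_eq_zero hv h
  have hCH := mulVec_mulVec_eq_trace_smul_sub (ρ μ) v
  rw [← hw] at hCH
  have htr : (ρ μ : Matrix (Fin 2) (Fin 2) ℂ).trace = 0 := by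
    obtain ⟨b, hb⟩ := hNw γ₀ hγ₀
    obtain ⟨e, he⟩ := hconj w hNw γ₀ hγ₀
    have hba : b - a ≠ 0 := fun h => hns ⟨a, mulVec_eq_smul_of_det_ne_zero hD hav
      (by rw [← sub_eq_zero.1 h]; exact hb)⟩
    rw [hCH, mulVec_sub, mulVec_smul, hav, hb] at he
    have h0 := congrFun he 0
    have h1 := congrFun he 1
    simp only [Pi.sub_apply, Pi.smul_apply, smul_eq_mul] at h0 h1
    set τ := (ρ μ : Matrix (Fin 2) (Fin 2) ℂ).trace
    have hea : e = a := by
      apply mul_right_cancel₀ hD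
      linear_combination w 0 * h1 - w 1 * h0
    subst hea
    have h : τ * (b - e) * (w 0 * v 1 - v 0 * w 1) = 0 := by
      linear_combination v 1 * h0 - v 0 * h1
    simpa [hba, hD] using h
  obtain ⟨P, hPM, hPN⟩ := exists_conj_eq_Jmat (N := ρ '' (commutator G : Set G)) hD hw.symm
    (by rw [hCH, htr, zero_smul, zero_sub]) (Set.forall_mem_image.2 hNv)
    (Set.forall_mem_image.2 hNw)
  exact ⟨P, hPM, fun γ hγ => hPN _ (Set.mem_image_of_mem ρ hγ)⟩
end

section
/- Let n ≥ 1 and let W be an n×n matrix with integer entries whose determinant is odd (in particular nonzero). Consider the set S = {α : Fin n → ℂˣ | for every i, ∏_j (α j)^{W i j} = 1}, which is invariant under the componentwise inversion α ↦ α⁻¹. Then the only element of S fixed by inversion is the constant function 1, and the number of orbits of the inversion action on S equals (|det W| + 1)/2; equivalently, the number of unordered pairs {α, α⁻¹} with α ∈ S and α ≠ α⁻¹ equals (|det W| − 1)/2. -/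
/-- The `ℤ`-span of the rows of an integer matrix. -/
def rowLattice {n : ℕ} (W : Matrix (Fin n) (Fin n) ℤ) : Submodule ℤ (Fin n → ℤ) :=
  LinearMap.range W.transpose.mulVecLin

theorem row_mem_rowLattice {n : ℕ} (W : Matrix (Fin n) (Fin n) ℤ) (i : Fin n) :
    W i ∈ rowLattice W :=
  ⟨Pi.single i 1, by ext j; simp⟩

theorem card_quotient_rowLattice {n : ℕ} (W : Matrix (Fin n) (Fin n) ℤ) (hW : W.det ≠ 0) :
    Nat.card ((Fin n → ℤ) ⧸ rowLattice W) = W.det.natAbs := by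
  have hinj : Function.Injective W.transpose.mulVecLin :=
    (injective_iff_map_eq_zero _).2 fun _ ↦
      Matrix.eq_zero_of_mulVec_eq_zero (by rwa [Matrix.det_transpose])
  rw [← Submodule.natAbs_det_equiv (rowLattice W) (LinearEquiv.ofInjective _ hinj),
    ← Matrix.det_transpose W, ← LinearMap.det_toLin']
  rfl

/-- The values on the standard basis of a homomorphism from `ℤⁿ` modulo the row lattice. -/
def rowLatticeDualCoords {n : ℕ} (W : Matrix (Fin n) (Fin n) ℤ) (A : Type*) [CommGroup A]
    (φ : Multiplicative ((Fin n → ℤ) ⧸ rowLattice W) →* A) : Fin n → A :=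
  fun j ↦ φ (.ofAdd ((rowLattice W).mkQ (Pi.single j 1)))

theorem map_mkQ_eq_prod_rowLatticeDualCoords {n : ℕ} (W : Matrix (Fin n) (Fin n) ℤ)
    {A : Type*} [CommGroup A] (φ : Multiplicative ((Fin n → ℤ) ⧸ rowLattice W) →* A)
    (v : Fin n → ℤ) :
    φ (.ofAdd ((rowLattice W).mkQ v)) = ∏ j, rowLatticeDualCoords W A φ j ^ v j := by
  conv_lhs => rw [pi_eq_sum_univ' v]
  simp only [map_sum, map_smul, ofAdd_sum, ofAdd_zsmul, map_prod, map_zpow]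
  rfl

theorem rowLatticeDualCoords_injective {n : ℕ} (W : Matrix (Fin n) (Fin n) ℤ)
    (A : Type*) [CommGroup A] : Function.Injective (rowLatticeDualCoords W A) := by
  intro φ ψ h
  refine MonoidHom.ext fun x ↦ ?_
  obtain ⟨v, rfl⟩ : ∃ v, x = .ofAdd ((rowLattice W).mkQ v) :=
    ((rowLattice W).mkQ_surjective x.toAdd).imp fun _ h ↦ by rw [h, ofAdd_toAdd]
  simp only [map_mkQ_eq_prod_rowLatticeDualCoords, h]

theorem range_rowLatticeDualCoords {n : ℕ} (W : Matrix (Fin n) (Fin n) ℤ)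
    (A : Type*) [CommGroup A] :
    Set.range (rowLatticeDualCoords W A) = {α | ∀ i, ∏ j, α j ^ W i j = 1} := by
  ext α
  constructor
  · rintro ⟨φ, rfl⟩ i
    rw [← map_mkQ_eq_prod_rowLatticeDualCoords, Submodule.mkQ_apply,
      (Submodule.Quotient.mk_eq_zero _).2 (row_mem_rowLattice W i), ofAdd_zero, map_one]
  · intro h
    let f : (Fin n → ℤ) →ₗ[ℤ] Additive A :=
      (Pi.basisFun ℤ (Fin n)).constr ℤ fun j ↦ Additive.ofMul (α j)
    have hf (v : Fin n → ℤ) : f v = Additive.ofMul (∏ j, α j ^ v j) := by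
      simp [f, Module.Basis.constr_apply_fintype]
    have hker : rowLattice W ≤ LinearMap.ker f := by
      rintro _ ⟨v, rfl⟩
      have : W.transpose.mulVecLin v = ∑ i, v i • W i := by
        ext j
        simp [Matrix.vecMul, dotProduct]
      rw [LinearMap.mem_ker, this, map_sum]
      refine Finset.sum_eq_zero fun i _ ↦ ?_
      rw [map_smul, hf, h i, ofMul_one, smul_zero]
    refine ⟨AddMonoidHom.toMultiplicativeLeft ((rowLattice W).liftQ f hker).toAddMonoidHom, ?_⟩
    ext j
    change Additive.toMul (f (Pi.single j 1)) = α j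
    rw [hf, toMul_ofMul, Finset.prod_eq_single j] <;> simp +contextual

theorem ncard_monomial_solutions {n : ℕ} (W : Matrix (Fin n) (Fin n) ℤ) (hW : W.det ≠ 0)
    (K : Type*) [Field K] [IsSepClosed K] [CharZero K] :
    {α : Fin n → Kˣ | ∀ i, ∏ j, α j ^ W i j = 1}.ncard = W.det.natAbs := by
  have hcard := card_quotient_rowLattice W hW
  have : Finite (Multiplicative ((Fin n → ℤ) ⧸ rowLattice W)) :=
    Nat.finite_of_card_ne_zero (α := (Fin n → ℤ) ⧸ rowLattice W) (by simpa [hcard])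
  have : NeZero (Monoid.exponent (Multiplicative ((Fin n → ℤ) ⧸ rowLattice W)) : K) :=
    ⟨Nat.cast_ne_zero.2 Monoid.exponent_ne_zero_of_finite⟩
  rw [← range_rowLatticeDualCoords, ← Nat.card_coe_set_eq,
    Nat.card_range_of_injective (rowLatticeDualCoords_injective W Kˣ),
    CommGroup.card_monoidHom_of_hasEnoughRootsOfUnity, ← hcard]
  rfl

theorem pow_natAbs_det_eq_one {n : ℕ} (W : Matrix (Fin n) (Fin n) ℤ) (hW : W.det ≠ 0)
    {A : Type*} [CommGroup A] {α : Fin n → A} (hα : ∀ i, ∏ j, α j ^ W i j = 1) :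
    α ^ W.det.natAbs = 1 := by
  obtain ⟨φ, rfl⟩ := (range_rowLatticeDualCoords W A).ge hα
  ext j
  rw [← card_quotient_rowLattice W hW]
  change φ _ ^ Nat.card (Multiplicative ((Fin n → ℤ) ⧸ rowLattice W)) = 1
  rw [← map_pow, pow_card_eq_one', map_one]

theorem two_mul_ncard_involution_pairs {X : Type*} (σ : X → X) (hσ : Function.Involutive σ)
    {T : Set X} (hT : T.Finite) (hmaps : ∀ a ∈ T, σ a ∈ T) (hfix : ∀ a ∈ T, a ≠ σ a) :
    2 * {p : Set X | ∃ a ∈ T, p = {a, σ a}}.ncard = T.ncard := by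
  classical
  lift T to Finset X using hT
  have hset : {p : Set X | ∃ a ∈ (T : Set X), p = {a, σ a}} =
      (T.image fun a ↦ ({a, σ a} : Set X) : Finset (Set X)) := by
    ext p
    simp [eq_comm]
  rw [hset, Set.ncard_coe_finset, Set.ncard_coe_finset, mul_comm]
  symm
  rw [Finset.card_eq_sum_card_image fun a ↦ ({a, σ a} : Set X)]
  apply Finset.sum_const_nat
  intro p hp
  obtain ⟨a, ha, rfl⟩ := Finset.mem_image.1 hp
  have : {x ∈ T | ({x, σ x} : Set X) = {a, σ a}} = {a, σ a} := by
    ext x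
    simp only [Finset.mem_filter, Finset.mem_insert, Finset.mem_singleton]
    constructor
    · rintro ⟨-, h⟩
      simpa using h.le (Set.mem_insert x _)
    · rintro (rfl | rfl)
      · exact ⟨ha, rfl⟩
      · exact ⟨hmaps a ha, by rw [hσ a, Set.pair_comm]⟩
  rw [this, Finset.card_pair (hfix a ha)]


/-- for an `n × n` integer matrix `W` with odd determinant, on the solution set
`S = {α : Fin n → ℂˣ | ∀ i, ∏ j (α j)^{W i j} = 1}` (which is invariant under componentwise
inversion) the only fixed point of inversion is the constant function `1`, the number of
orbits of the inversion action is `(|det W| + 1)/2`, and the number of unordered pairs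
`{α, α⁻¹}` with `α ≠ α⁻¹` is `(|det W| - 1)/2`. -/
theorem inversion_action_on_solutions (n : ℕ) (hn : 1 ≤ n)
    (W : Matrix (Fin n) (Fin n) ℤ) (hW : Odd W.det)
    (S : Set (Fin n → ℂˣ))
    (hS : S = {α : Fin n → ℂˣ | ∀ i : Fin n, ∏ j : Fin n, (α j) ^ (W i j) = 1})
    (hinv : ∀ α ∈ S, α⁻¹ ∈ S) :
    (∀ α ∈ S, α⁻¹ = α → α = 1) ∧
    ({p : Set (Fin n → ℂˣ) | ∃ α ∈ S, p = {α, α⁻¹}}).ncard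
      = ((W.det).natAbs + 1) / 2 ∧
    ({p : Set (Fin n → ℂˣ) | ∃ α ∈ S, α ≠ α⁻¹ ∧ p = {α, α⁻¹}}).ncard
      = ((W.det).natAbs - 1) / 2 := by

  have hdet : W.det ≠ 0 := by rintro h; simp [h] at hW
  have hodd : Odd W.det.natAbs := Int.natAbs_odd.2 hW
  have hcard : S.ncard = W.det.natAbs := hS ▸ ncard_monomial_solutions W hdet ℂ
  have hfin : S.Finite := Set.finite_of_ncard_ne_zero (by simpa [hcard])
  have hone : (1 : Fin n → ℂˣ) ∈ S := by simp [hS]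
  have hfix : ∀ α ∈ S, α⁻¹ = α → α = 1 := by
    intro α hα h
    have h2 : α ^ 2 = 1 := by rw [pow_two, ← inv_eq_iff_mul_eq_one, h]
    have hd : α ^ W.det.natAbs = 1 := pow_natAbs_det_eq_one W hdet (by simpa [hS] using hα)
    simpa [hodd.coprime_two_left.gcd_eq_one] using pow_gcd_eq_one.2 ⟨h2, hd⟩
  have hpairs : {p : Set (Fin n → ℂˣ) | ∃ α ∈ S, α ≠ α⁻¹ ∧ p = {α, α⁻¹}} =
      {p | ∃ α ∈ S \ {1}, p = {α, α⁻¹}} := by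
    ext p
    refine exists_congr fun α ↦ ?_
    constructor
    · rintro ⟨hα, hne, hp⟩
      exact ⟨⟨hα, by rintro rfl; simp at hne⟩, hp⟩
    · rintro ⟨⟨hα, hne⟩, hp⟩
      exact ⟨hα, fun h ↦ hne (hfix α hα h.symm), hp⟩
  have htwo := two_mul_ncard_involution_pairs (fun α : Fin n → ℂˣ ↦ α⁻¹) inv_involutive
    (hfin.sdiff (t := {1})) (fun α hα ↦ ⟨hinv α hα.1, by simpa using hα.2⟩)
    (fun α hα h ↦ hα.2 (hfix α hα.1 h.symm))
  rw [Set.ncard_sdiff_singleton_of_mem hone, hcard] at htwo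
  have horbits : {p : Set (Fin n → ℂˣ) | ∃ α ∈ S, p = {α, α⁻¹}} =
      insert {1} {p | ∃ α ∈ S \ {1}, p = {α, α⁻¹}} := by
    ext p
    constructor
    · rintro ⟨α, hα, rfl⟩
      by_cases h : α = 1
      · left; simp [h]
      · exact .inr ⟨α, ⟨hα, h⟩, rfl⟩
    · rintro (rfl | ⟨α, hα, rfl⟩)
      · exact ⟨1, hone, by simp⟩
      · exact ⟨α, hα.1, rfl⟩
  have hnot : ({1} : Set (Fin n → ℂˣ)) ∉
      {p : Set (Fin n → ℂˣ) | ∃ α ∈ S \ {1}, p = {α, α⁻¹}} := by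
    rintro ⟨α, hα, h⟩
    exact hα.2 (h.ge (Set.mem_insert α _))
  have hpfin : {p : Set (Fin n → ℂˣ) | ∃ α ∈ S \ {1}, p = {α, α⁻¹}}.Finite :=
    ((hfin.sdiff (t := {1})).image fun α ↦ ({α, α⁻¹} : Set (Fin n → ℂˣ))).subset
      (by rintro _ ⟨α, hα, rfl⟩; exact ⟨α, hα, rfl⟩)
  rw [hpairs, horbits, Set.ncard_insert_of_notMem hnot hpfin]
  obtain ⟨k, hk⟩ := hodd
  refine ⟨hfix, ?_, ?_⟩ <;> omega
end

section
/- Let G be a group, α : G → ℤ a group homomorphism, μ ∈ G with α(μ) = 1, and let H = {g ∈ G : α(g) is even} (a normal subgroup of G). Let ρ, ρ′ : G → SL₂(ℂ) be homomorphisms and P ∈ SL₂(ℂ) such that ρ′(h) = P ρ(h) P⁻¹ for every h ∈ H, and suppose the restriction of ρ to H is irreducible. Then either ρ′(g) = P ρ(g) P⁻¹ for every g ∈ G, or ρ′(g) = (−1)^{α(g)} · P ρ(g) P⁻¹ for every g ∈ G. In particular, the character of ρ′ equals the character of either ρ or of its twist ι(ρ) : g ↦ (−1)^{α(g)} ρ(g).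 -/
open Matrix

/-- Schur's lemma for `2 × 2` matrices: if the matrices `M` in a set without common eigenvector all
commute with `A`, then `A` is scalar. -/
theorem exists_eq_smul_one_of_commute {K : Type*} [Field K] [IsAlgClosed K]
    (S : Set (Matrix (Fin 2) (Fin 2) K))
    (hS : ¬ ∃ v : Fin 2 → K, v ≠ 0 ∧ ∀ M ∈ S, ∃ c : K, M *ᵥ v = c • v)
    (A : Matrix (Fin 2) (Fin 2) K) (hA : ∀ M ∈ S, A * M = M * A) :
    ∃ c : K, A = c • 1 := by
  obtain ⟨c, hc⟩ := Module.End.exists_eigenvalue (Matrix.toLin' A)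
  refine ⟨c, ?_⟩
  set E := Module.End.eigenspace (Matrix.toLin' A) c
  have mem_E (w : Fin 2 → K) : w ∈ E ↔ A *ᵥ w = c • w := by
    simp [E]
  obtain ⟨v, hvE, hv⟩ := hc.exists_hasEigenvector
  have hE : E = ⊤ := by
    by_contra hE
    have hlt : Module.finrank K E < 2 := by
      simpa using Submodule.finrank_lt hE
    have hne : (⟨v, hvE⟩ : E) ≠ 0 := by simpa [Subtype.ext_iff] using hv
    have hpos : 0 < Module.finrank K E := Module.finrank_pos_iff_exists_ne_zero.mpr ⟨_, hne⟩
    have hone : Module.finrank K E = 1 := by omega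
    refine hS ⟨v, hv, fun M hM => ?_⟩
    have hMv : M *ᵥ v ∈ E := by
      rw [mem_E, Matrix.mulVec_mulVec, hA M hM, ← Matrix.mulVec_mulVec, (mem_E v).mp hvE,
        Matrix.mulVec_smul]
    obtain ⟨d, hd⟩ := (finrank_eq_one_iff_of_nonzero' _ hne).mp hone ⟨_, hMv⟩
    exact ⟨d, (congrArg Subtype.val hd).symm⟩
  refine Matrix.toLin'.injective (LinearMap.ext fun w => ?_)
  have hw : A *ᵥ w = c • w := (mem_E w).mp (hE ▸ Submodule.mem_top)
  simpa [Matrix.smul_mulVec] using hw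

/-- An element of `SL₂(ℂ)` commuting with a set without common eigenvector is `1` or `-1`. -/
theorem SL2C.eq_one_or_eq_neg_one_of_commute (S : Set SL2C)
    (hS : ¬ ∃ v : Fin 2 → ℂ, v ≠ 0 ∧
      ∀ M ∈ S, ∃ c : ℂ, (M : Matrix (Fin 2) (Fin 2) ℂ) *ᵥ v = c • v)
    (A : SL2C) (hA : ∀ M ∈ S, A * M = M * A) : A = 1 ∨ A = -1 := by
  obtain ⟨c, hc⟩ := exists_eq_smul_one_of_commute
    ((fun M : SL2C => (M : Matrix (Fin 2) (Fin 2) ℂ)) '' S) (by simpa using hS) A (by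
      rintro _ ⟨M, hM, rfl⟩
      exact_mod_cast congrArg (fun B : SL2C => (B : Matrix (Fin 2) (Fin 2) ℂ)) (hA M hM))
  have hdet : c ^ 2 = 1 := by
    have h := A.det_coe
    rw [hc] at h
    simpa [Matrix.det_smul] using h
  rcases eq_or_eq_neg_of_sq_eq_sq c 1 (by simpa using hdet) with rfl | rfl
  · exact Or.inl (Subtype.ext (by simpa using hc))
  · exact Or.inr (Subtype.ext (by simpa using hc))

/-- if two representations of `G` agree up to conjugation by `P` on the
index-two subgroup `H = {g : α g even}` and the restriction of `ρ` to `H` is irreducible,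
then `ρ'` equals `P ρ P⁻¹` or its twist `g ↦ (-1)^{α g} P ρ(g) P⁻¹` globally; in particular
the character of `ρ'` equals that of `ρ` or of `ι(ρ)`. -/
theorem rep_agreeing_on_even_part_eq_or_twist {G : Type*} [Group G]
    (α : G → ℤ) (hα : ∀ g h : G, α (g * h) = α g + α h)
    (μ : G) (hμ : α μ = 1)
    (ρ ρ' : G →* SL2C) (P : SL2C)
    (hH : ∀ h : G, Even (α h) → ρ' h = P * ρ h * P⁻¹)
    (hirr : ¬ ∃ v : Fin 2 → ℂ, v ≠ 0 ∧
      ∀ h : G, Even (α h) →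
        ∃ c : ℂ, (ρ h : Matrix (Fin 2) (Fin 2) ℂ) *ᵥ v = c • v) :
    ((∀ g : G, ρ' g = P * ρ g * P⁻¹) ∨
      (∀ g : G, ((ρ' g : SL2C) : Matrix (Fin 2) (Fin 2) ℂ)
        = ((-1 : ℂ) ^ (α g)) • ((P * ρ g * P⁻¹ : SL2C) : Matrix (Fin 2) (Fin 2) ℂ))) ∧
    ((∀ g : G, Matrix.trace ((ρ' g : Matrix (Fin 2) (Fin 2) ℂ))
        = Matrix.trace ((ρ g : Matrix (Fin 2) (Fin 2) ℂ))) ∨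
      (∀ g : G, Matrix.trace ((ρ' g : Matrix (Fin 2) (Fin 2) ℂ))
        = ((-1 : ℂ) ^ (α g)) * Matrix.trace ((ρ g : Matrix (Fin 2) (Fin 2) ℂ)))) := by
  have hα1 : α 1 = 0 := by simpa using hα 1 1
  have hαinv (g : G) : α g⁻¹ = -α g := by
    have h := hα g⁻¹ g
    rw [inv_mul_cancel, hα1] at h
    omega
  have hcomm : ∀ h : G, Even (α h) →
      (ρ μ)⁻¹ * (P⁻¹ * ρ' μ * P) * ρ h = ρ h * ((ρ μ)⁻¹ * (P⁻¹ * ρ' μ * P)) := by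
    intro h hh
    have hconj := hH (μ * h * μ⁻¹) (by simpa [hα, hαinv] using hh)
    simp only [map_mul, map_inv, hH h hh] at hconj
    have key : ρ' μ * P * ρ h = P * ρ μ * ρ h * (ρ μ)⁻¹ * P⁻¹ * ρ' μ * P := by
      calc ρ' μ * P * ρ h = ρ' μ * (P * ρ h * P⁻¹) * (ρ' μ)⁻¹ * ρ' μ * P := by group
        _ = _ := by rw [hconj]; group
    calc _ = (ρ μ)⁻¹ * P⁻¹ * (ρ' μ * P * ρ h) := by group
      _ = _ := by rw [key]; group
  have hodd {g : G} (hg : ¬ Even (α g)) :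
      ρ' g = P * ρ μ * ((ρ μ)⁻¹ * (P⁻¹ * ρ' μ * P)) * (ρ μ)⁻¹ * ρ g * P⁻¹ := by
    have h := hH (μ⁻¹ * g) (by
      rw [hα, hαinv, hμ, Int.even_add]
      simp [hg])
    calc ρ' g = ρ' μ * ρ' (μ⁻¹ * g) := by rw [← map_mul, mul_inv_cancel_left]
      _ = _ := by rw [h, map_mul, map_inv]; group
  have htr (g : G) : Matrix.trace ((P * ρ g * P⁻¹ : SL2C) : Matrix (Fin 2) (Fin 2) ℂ)
      = Matrix.trace (ρ g : Matrix (Fin 2) (Fin 2) ℂ) := by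
    rw [Matrix.SpecialLinearGroup.coe_mul, Matrix.trace_mul_comm,
      ← Matrix.SpecialLinearGroup.coe_mul, inv_mul_cancel_left]
  rcases SL2C.eq_one_or_eq_neg_one_of_commute (ρ '' {h | Even (α h)}) (by simpa using hirr)
    ((ρ μ)⁻¹ * (P⁻¹ * ρ' μ * P)) (by rintro _ ⟨h, hh, rfl⟩; exact hcomm h hh) with hC | hC
  · have heq (g : G) : ρ' g = P * ρ g * P⁻¹ := by
      by_cases hg : Even (α g)
      · exact hH g hg
      · rw [hodd hg, hC]
        group
    exact ⟨Or.inl heq, Or.inl fun g => by rw [heq, htr]⟩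
  · have heq (g : G) : (ρ' g : Matrix (Fin 2) (Fin 2) ℂ)
        = ((-1 : ℂ) ^ α g) • ((P * ρ g * P⁻¹ : SL2C) : Matrix (Fin 2) (Fin 2) ℂ) := by
      by_cases hg : Even (α g)
      · rw [hH g hg, hg.neg_one_zpow, one_smul]
      · have h : ρ' g = -(P * ρ g * P⁻¹) := by
          rw [hodd hg, hC]
          simp only [mul_neg, neg_mul, mul_one, mul_inv_cancel_right]
        rw [h, (Int.not_even_iff_odd.mp hg).neg_one_zpow, neg_one_smul,
          Matrix.SpecialLinearGroup.coe_neg]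
    exact ⟨Or.inr heq, Or.inr fun g => by rw [heq, Matrix.trace_smul, htr, smul_eq_mul]⟩
end
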